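/- In the quasi-consecutive pattern poset, suppose σ occurs exactly once in τ = a_1 a_2 ⋯ a_n. Then μ(σ, τ) = 0 unless one of the following holds: (i) σ = τ, when μ = 1; (ii) τ covers σ, when μ = −1; (iii) [σ,τ] has rank 2 and the occurrence involves exactly one of a_1, a_2 and not a_n, when μ = 1; (iv) [σ,τ] has rank 2, the occurrence involves a_n but neither a_1 nor a_2, and a_1, a_2 are not consecutive integers, when μ = 1; (v) [σ,τ] has rank 3, the occurrence is consecutive, involves a_{n−1} but none of a_1, a_2, a_n, and τ covers three elements of [σ,τ], when μ = −1. -/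

import Mathlib

open scoped Classical

/-- A finite permutation of arbitrary length: a length `n` together with a
permutation of `Fin n` (in one-line notation, the entry at position `i` is
its value at `i`). -/
abbrev QPerm : Type := Σ n : ℕ, Equiv.Perm (Fin n)

/-- `IsOcc a σ τ f` : the strictly monotone position map `f` selects an
occurrence of the pattern `σ` in `τ` (order-isomorphically), where for every
gap index `j ≥ 1` (1-indexed) with `a j = false` the `j`-th and `(j+1)`-th
selected positions must be adjacent in `τ`. -/
def IsOcc (a : ℕ → Bool) {k n : ℕ} (σ : Equiv.Perm (Fin k)) (τ : Equiv.Perm (Fin n))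
    (f : Fin k → Fin n) : Prop :=
  StrictMono f ∧ (∀ i j : Fin k, σ i < σ j ↔ τ (f i) < τ (f j)) ∧
    ∀ (i : ℕ) (h : i + 1 < k), a (i + 1) = false →
      (f ⟨i + 1, h⟩ : ℕ) = (f ⟨i, Nat.lt_of_succ_lt h⟩ : ℕ) + 1

/-- `σ` occurs in `τ` as an `a`-vincular pattern. -/
def VOcc (a : ℕ → Bool) (σ τ : QPerm) : Prop :=
  ∃ f : Fin σ.1 → Fin τ.1, IsOcc a σ.2 τ.2 f

/-- Covering relation of the `a`-vincular pattern poset. -/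
def VCov (a : ℕ → Bool) (σ τ : QPerm) : Prop :=
  σ.1 + 1 = τ.1 ∧ VOcc a σ τ

/-- The `a`-vincular pattern order: reflexive-transitive closure of covering. -/
def VLe (a : ℕ → Bool) (σ τ : QPerm) : Prop :=
  Relation.ReflTransGen (VCov a) σ τ

/-- Occurrence as an `A`-vincular pattern for a matrix `A` (rows and columns
1-indexed via `A i j`); a pattern of length `k` uses row `k - 1`. -/
def MOcc (A : ℕ → ℕ → Bool) (σ τ : QPerm) : Prop :=
  VOcc (fun j => A (σ.1 - 1) j) σ τ

/-- Covering relation of the `A`-vincular pattern poset. -/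
def MCov (A : ℕ → ℕ → Bool) (σ τ : QPerm) : Prop :=
  σ.1 + 1 = τ.1 ∧ MOcc A σ τ

/-- The `A`-vincular pattern order. -/
def MLe (A : ℕ → ℕ → Bool) (σ τ : QPerm) : Prop :=
  Relation.ReflTransGen (MCov A) σ τ

/-- The quasi-consecutive adjacency vector `a = (1,0,0,…)` (1-indexed). -/
def qa : ℕ → Bool := fun j => decide (j = 1)

/-- Quasi-consecutive pattern occurrence. -/
def QOcc (σ τ : QPerm) : Prop := VOcc qa σ τ

/-- Covering in the quasi-consecutive pattern poset. -/
def QCov (σ τ : QPerm) : Prop := VCov qa σ τ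

/-- The quasi-consecutive pattern poset order. -/
def QLe (σ τ : QPerm) : Prop := VLe qa σ τ

/-- All permutations of length at most `n`, as a finset. -/
def permsUpTo (n : ℕ) : Finset QPerm :=
  (Finset.range (n + 1)).sigma fun _ => Finset.univ

/-- Möbius function of the quasi-consecutive pattern poset, computed with
fuel (the fuel `τ.1` always suffices, since lengths strictly increase along
the order). -/
noncomputable def qMuAux : ℕ → QPerm → QPerm → ℤ
  | 0, σ, τ => if σ = τ then 1 else 0
  | m + 1, σ, τ =>
      if σ = τ then 1
      else -∑ z ∈ (permsUpTo τ.1).filter fun z => QLe σ z ∧ QLe z τ ∧ z ≠ τ,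
            qMuAux m σ z

/-- The Möbius function of the quasi-consecutive pattern poset. -/
noncomputable def qMu (σ τ : QPerm) : ℤ := qMuAux τ.1 σ τ

/-- The interval `[σ, τ]` in the quasi-consecutive pattern poset. -/
def QInterval (σ τ : QPerm) : Set QPerm := {ρ | QLe σ ρ ∧ QLe ρ τ}

/-- The interval `[σ, τ]` is a chain. -/
def QChain (σ τ : QPerm) : Prop :=
  ∀ ρ₁ ρ₂ : QPerm, ρ₁ ∈ QInterval σ τ → ρ₂ ∈ QInterval σ τ → QLe ρ₁ ρ₂ ∨ QLe ρ₂ ρ₁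

/-- The interval `[σ, τ]` is order-isomorphic to the product of a chain with
`p + 1` elements and a chain with `q + 1` elements (componentwise order). -/
def IsGridInterval (σ τ : QPerm) (p q : ℕ) : Prop :=
  ∃ e : QInterval σ τ ≃ Fin (p + 1) × Fin (q + 1),
    ∀ ρ₁ ρ₂ : QInterval σ τ, QLe ρ₁.1 ρ₂.1 ↔ e ρ₁ ≤ e ρ₂

/-- The occurrence `f` involves position `i` (0-indexed) of the big permutation. -/
def Involves {k n : ℕ} (f : Fin k → Fin n) (i : ℕ) : Prop :=
  ∃ j : Fin k, (f j : ℕ) = i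

/-- The occurrence `f` is consecutive: all selected positions are adjacent. -/
def ConsecOcc {k n : ℕ} (f : Fin k → Fin n) : Prop :=
  ∀ (i : ℕ) (h : i + 1 < k),
    (f ⟨i + 1, h⟩ : ℕ) = (f ⟨i, Nat.lt_of_succ_lt h⟩ : ℕ) + 1

/-- The first two entries of `τ` are not consecutive integers. -/
def NotConsecFirstTwo (τ : QPerm) : Prop :=
  ∀ i j : Fin τ.1, (i : ℕ) = 0 → (j : ℕ) = 1 →
    (τ.2 i : ℕ) + 1 ≠ (τ.2 j : ℕ) ∧ (τ.2 j : ℕ) + 1 ≠ (τ.2 i : ℕ)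

/-- `τ` is a monotone (increasing or decreasing) permutation. -/
def IsMonotonePerm (τ : QPerm) : Prop :=
  (∀ i j : Fin τ.1, i < j → τ.2 i < τ.2 j) ∨ (∀ i j : Fin τ.1, i < j → τ.2 j < τ.2 i)

section MainTheorem

variable (σ τ : QPerm) (f : Fin σ.1 → Fin τ.1)

/-- Case (iii): rank 2, the occurrence involves exactly one of `a₁, a₂` and
not `aₙ`. -/
def CaseThree : Prop :=
  τ.1 - σ.1 = 2 ∧ ¬ Involves f (τ.1 - 1) ∧
    ((Involves f 0 ∧ ¬ Involves f 1) ∨ (Involves f 1 ∧ ¬ Involves f 0))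

/-- Case (iv): rank 2, the occurrence involves `aₙ` but neither `a₁` nor
`a₂`, and `a₁, a₂` are not consecutive integers. -/
def CaseFour : Prop :=
  τ.1 - σ.1 = 2 ∧ Involves f (τ.1 - 1) ∧ ¬ Involves f 0 ∧ ¬ Involves f 1 ∧
    NotConsecFirstTwo τ

/-- Case (v): rank 3, consecutive occurrence involving `a_{n-1}` but none of
`a₁, a₂, aₙ`, and `τ` covers three elements of `[σ,τ]`. -/
def CaseFive : Prop :=
  τ.1 - σ.1 = 3 ∧ ConsecOcc f ∧ Involves f (τ.1 - 2) ∧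
    ¬ Involves f 0 ∧ ¬ Involves f 1 ∧ ¬ Involves f (τ.1 - 1) ∧
    {ρ : QPerm | QLe σ ρ ∧ QCov ρ τ}.ncard = 3

namespace QPattern

/-- The one-line notation of `τ` as a function on `ℕ`, extended by the identity. -/
def ev (τ : QPerm) (i : ℕ) : ℕ := if h : i < τ.1 then τ.2 ⟨i, h⟩ else i

/-- The positions `x, y, y + 1, y + 2, …` of a quasi-consecutive occurrence. -/
def pos (x y i : ℕ) : ℕ := if i = 0 then x else y + i - 1

/-- `ρ` occurs in `τ` at the positions `x, y, y + 1, …`. -/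
def Occ (ρ τ : QPerm) (x y : ℕ) : Prop :=
  x < y ∧ y + ρ.1 ≤ τ.1 + 1 ∧ ∀ i < ρ.1, ∀ j < ρ.1,
    (ev ρ i < ev ρ j ↔ ev τ (pos x y i) < ev τ (pos x y j))

/-- The pattern of length `m` formed by the entries of `τ` at the positions `x, y, y + 1, …`. -/
def pat (τ : QPerm) (m x y : ℕ) : QPerm :=
  ⟨m, (Tuple.sort fun i : Fin m => ev τ (pos x y i)).symm⟩

lemma ev_injective (τ : QPerm) : Function.Injective (ev τ) := by
  intro i j h
  unfold ev at h
  split_ifs at h with hi hj hj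
  · simpa using τ.2.injective (Fin.ext h)
  · have := (τ.2 ⟨i, hi⟩).2
    omega
  · have := (τ.2 ⟨j, hj⟩).2
    omega
  · exact h

lemma ev_of_lt {τ : QPerm} {i : ℕ} (h : i < τ.1) : ev τ i = τ.2 ⟨i, h⟩ := dif_pos h

lemma pos_zero (x y : ℕ) : pos x y 0 = x := rfl

lemma pos_succ (x y i : ℕ) : pos x y (i + 1) = y + i := by
  simp [pos]

lemma pos_injective {x y : ℕ} (h : x < y) : Function.Injective (pos x y) := by
  intro i j hij
  unfold pos at hij
  split_ifs at hij <;> omega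

lemma pos_pos {x y x' y' : ℕ} (h : x < y) (i : ℕ) :
    pos x' y' (pos x y i) = pos (pos x' y' x) (pos x' y' y) i := by
  unfold pos
  split_ifs <;> omega

lemma ext_of_order {ρ ρ' : QPerm} (h : ρ.1 = ρ'.1)
    (ho : ∀ i < ρ.1, ∀ j < ρ.1, (ev ρ i < ev ρ j ↔ ev ρ' i < ev ρ' j)) : ρ = ρ' := by
  obtain ⟨m, a⟩ := ρ
  obtain ⟨m', b⟩ := ρ'
  obtain rfl : m = m' := h
  have key : ∀ i j : Fin m, a i < a j ↔ b i < b j := by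
    intro i j
    have := ho i i.2 j j.2
    rw [ev_of_lt (τ := ⟨m, a⟩) i.2, ev_of_lt (τ := ⟨m, a⟩) j.2, ev_of_lt (τ := ⟨m, b⟩) i.2,
      ev_of_lt (τ := ⟨m, b⟩) j.2] at this
    exact this
  have hm : StrictMono (a.symm.trans b) := by
    intro i j hij
    have := (key (a.symm i) (a.symm j)).1 (by simpa using hij)
    simpa using this
  have hid : ⇑(a.symm.trans b) = id := by
    have h1 : Set.range (a.symm.trans b) = Set.range (id : Fin m → Fin m) := by
      rw [Equiv.range_eq_univ, Set.range_id]
    exact (StrictMono.range_inj hm strictMono_id).1 h1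
  have hab : a = b := by
    ext i
    have := congrFun hid (a i)
    simp only [Equiv.trans_apply, Equiv.symm_apply_apply, id] at this
    rw [this]
  rw [hab]

lemma ev_pat_lt {τ : QPerm} {m x y : ℕ} (hxy : x < y) {i j : ℕ} (hi : i < m) (hj : j < m) :
    ev (pat τ m x y) i < ev (pat τ m x y) j ↔ ev τ (pos x y i) < ev τ (pos x y j) := by
  set w : Fin m → ℕ := fun i => ev τ (pos x y i) with hw
  have hinj : Function.Injective w := fun a b hab =>
    Fin.ext (pos_injective hxy (ev_injective τ hab))
  have hs : StrictMono (w ∘ Tuple.sort w) :=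
    (Tuple.monotone_sort w).strictMono_of_injective (hinj.comp (Tuple.sort w).injective)
  rw [ev_of_lt (τ := pat τ m x y) hi, ev_of_lt (τ := pat τ m x y) hj]
  have := hs.lt_iff_lt (a := (Tuple.sort w).symm ⟨i, hi⟩)
    (b := (Tuple.sort w).symm ⟨j, hj⟩)
  simp only [Function.comp_apply, Equiv.apply_symm_apply] at this
  exact this.symm

lemma pat_eq_pat_iff {τ τ' : QPerm} {m x y x' y' : ℕ} (h : x < y) (h' : x' < y') :
    pat τ m x y = pat τ' m x' y' ↔ ∀ i < m, ∀ j < m,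
      (ev τ (pos x y i) < ev τ (pos x y j) ↔ ev τ' (pos x' y' i) < ev τ' (pos x' y' j)) := by
  constructor
  · intro e i hi j hj
    rw [← ev_pat_lt h hi hj, ← ev_pat_lt h' hi hj, e]
  · intro e
    refine ext_of_order rfl fun i (hi : i < m) j (hj : j < m) => ?_
    rw [ev_pat_lt h hi hj, ev_pat_lt h' hi hj]
    exact e i hi j hj

lemma occ_pat {τ : QPerm} {m x y : ℕ} (h : x < y) (hm : y + m ≤ τ.1 + 1) :
    Occ (pat τ m x y) τ x y :=
  ⟨h, hm, fun _ hi _ hj => ev_pat_lt h hi hj⟩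

lemma Occ.eq_pat {ρ τ : QPerm} {x y : ℕ} (h : Occ ρ τ x y) : ρ = pat τ ρ.1 x y :=
  ext_of_order rfl fun i hi j hj => by rw [ev_pat_lt h.1 hi hj]; exact h.2.2 i hi j hj

lemma pos_lt {x y m n i : ℕ} (h : x < y) (hm : y + m ≤ n + 1) (hi : i < m) : pos x y i < n := by
  unfold pos
  split_ifs <;> omega

lemma Occ.trans {ρ ζ τ : QPerm} {x y x' y' : ℕ} (h : Occ ρ ζ x y) (h' : Occ ζ τ x' y') :
    Occ ρ τ (pos x' y' x) (pos x' y' y) := by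
  obtain ⟨h1, h2, h3⟩ := h
  obtain ⟨h1', h2', h3'⟩ := h'
  refine ⟨?_, ?_, fun i hi j hj => ?_⟩
  · unfold pos
    split_ifs <;> omega
  · unfold pos
    split_ifs <;> omega
  · rw [h3 i hi j hj, h3' _ (pos_lt h1 h2 hi) _ (pos_lt h1 h2 hj), pos_pos h1, pos_pos h1]

/-- An occurrence in `τ` whose positions lie in an occurrence of `ζ` is an occurrence in `ζ`. -/
lemma Occ.factor {ρ ζ τ : QPerm} {x y x' y' : ℕ} (h' : Occ ζ τ x' y') (h1 : x < y)
    (h2 : y + ρ.1 ≤ ζ.1 + 1) (h : Occ ρ τ (pos x' y' x) (pos x' y' y)) : Occ ρ ζ x y := by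
  refine ⟨h1, h2, fun i hi j hj => ?_⟩
  rw [h.2.2 i hi j hj, h'.2.2 _ (pos_lt h1 h2 hi) _ (pos_lt h1 h2 hj), pos_pos h1, pos_pos h1]

lemma pat_pat {τ : QPerm} {m x y m' x' y' : ℕ} (h : x < y) (h' : x' < y') (hm' : y' + m' ≤ m + 1) :
    pat (pat τ m x y) m' x' y' = pat τ m' (pos x y x') (pos x y y') := by
  have h'' : pos x y x' < pos x y y' := by
    unfold pos
    split_ifs <;> omega
  rw [pat_eq_pat_iff h' h'']
  intro i hi j hj
  rw [ev_pat_lt h (pos_lt h' hm' hi) (pos_lt h' hm' hj), pos_pos h', pos_pos h']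

lemma pos_zero_one (i : ℕ) : pos 0 1 i = i := by
  unfold pos
  split_ifs <;> omega

lemma occ_refl (ρ : QPerm) : Occ ρ ρ 0 1 :=
  ⟨by omega, by omega, fun i _ j _ => by rw [pos_zero_one, pos_zero_one]⟩

lemma Occ.length_le {ρ τ : QPerm} {x y : ℕ} (h : Occ ρ τ x y) : ρ.1 ≤ τ.1 := by
  have := h.1
  have := h.2.1
  omega

lemma occ_of_isOcc {ρ τ : QPerm} (hρ : 2 ≤ ρ.1) {f : Fin ρ.1 → Fin τ.1}
    (hf : IsOcc qa ρ.2 τ.2 f) : ∃ x y, Occ ρ τ x y ∧ ∀ i, (f i : ℕ) = pos x y i := by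
  obtain ⟨h1, h2, h3⟩ := hf
  have hpos : ∀ i : Fin ρ.1, (f i : ℕ) = pos (f ⟨0, by omega⟩) (f ⟨1, by omega⟩) i := by
    rintro ⟨i, hi⟩
    induction i with
    | zero => simp [pos]
    | succ i ih =>
      rcases i with _ | i
      · simp [pos]
      · have := h3 (i + 1) hi (by simp [qa])
        rw [this, ih (by omega)]
        change pos _ _ (i + 1) + 1 = pos _ _ (i + 1 + 1)
        rw [pos_succ, pos_succ, add_assoc]
  refine ⟨_, _, ⟨h1 (Fin.mk_lt_mk.2 Nat.zero_lt_one), ?_, ?_⟩, hpos⟩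
  · have h4 := hpos ⟨ρ.1 - 1, by omega⟩
    have h5 := (f ⟨ρ.1 - 1, by omega⟩).2
    simp only [pos] at h4
    split_ifs at h4 <;> omega
  · intro i hi j hj
    have h4 := h2 ⟨i, hi⟩ ⟨j, hj⟩
    rw [← hpos ⟨i, hi⟩, ← hpos ⟨j, hj⟩, ev_of_lt hi, ev_of_lt hj, ev_of_lt (Fin.isLt _),
      ev_of_lt (Fin.isLt _)]
    exact h4

lemma Occ.exists_isOcc {ρ τ : QPerm} {x y : ℕ} (h : Occ ρ τ x y) :
    ∃ f : Fin ρ.1 → Fin τ.1, IsOcc qa ρ.2 τ.2 f ∧ ∀ i, (f i : ℕ) = pos x y i := by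
  obtain ⟨h1, h2, h3⟩ := h
  refine ⟨fun i => ⟨pos x y i, pos_lt h1 h2 i.2⟩, ⟨?_, ?_, ?_⟩, fun _ => rfl⟩
  · intro i j hij
    have : (i : ℕ) < j := hij
    change pos x y i < pos x y j
    unfold pos
    split_ifs <;> omega
  · intro i j
    have := h3 i i.2 j j.2
    rw [ev_of_lt i.2, ev_of_lt j.2, ev_of_lt (pos_lt h1 h2 i.2),
      ev_of_lt (pos_lt h1 h2 j.2)] at this
    exact this
  · intro i hi ha
    have : i ≠ 0 := by
      rintro rfl
      simp [qa] at ha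
    change pos x y (i + 1) = pos x y i + 1
    obtain ⟨j, rfl⟩ := Nat.exists_eq_succ_of_ne_zero this
    rw [pos_succ, pos_succ, add_assoc]

lemma QLe.exists_occ {ρ τ : QPerm} (hρ : 2 ≤ ρ.1) (h : QLe ρ τ) : ∃ x y, Occ ρ τ x y := by
  induction h with
  | refl => exact ⟨0, 1, occ_refl ρ⟩
  | tail _ hc ih =>
    obtain ⟨x, y, hxy⟩ := ih
    obtain ⟨_, f, hf⟩ := hc
    obtain ⟨x', y', h', _⟩ := occ_of_isOcc (hρ.trans hxy.length_le) hf
    exact ⟨_, _, hxy.trans h'⟩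

lemma qCov_pat {τ : QPerm} {m x y : ℕ} (h : x < y) (hy : y ≤ 2) (hm : m + 1 = τ.1) :
    QCov (pat τ m x y) τ :=
  ⟨hm, (occ_pat h (by omega)).exists_isOcc.imp fun _ hf => hf.1⟩

lemma Occ.qLe {ρ τ : QPerm} {x y : ℕ} (h : Occ ρ τ x y) : QLe ρ τ := by
  obtain ⟨n, hn⟩ : ∃ n, τ.1 = n := ⟨_, rfl⟩
  induction n generalizing τ x y with
  | zero =>
    have := h.length_le
    obtain rfl : ρ = τ := ext_of_order (by omega) (by intro i hi; omega)
    exact Relation.ReflTransGen.refl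
  | succ n ih =>
    have h1 := h.1
    have h2 := h.2.1
    suffices H : ∃ x' y' a b, x' < y' ∧ y' ≤ 2 ∧ a < b ∧ b + ρ.1 ≤ n + 1 ∧ pos x' y' a = x ∧
        pos x' y' b = y ∨ ρ = τ by
      obtain ⟨x', y', a, b, ⟨hx, hy, hab, hb, rfl, rfl⟩ | rfl⟩ := H
      · have hocc := Occ.factor (occ_pat (τ := τ) (m := n) hx (by omega)) hab hb h
        exact Relation.ReflTransGen.tail (ih hocc rfl) (qCov_pat hx hy hn.symm)
      · exact Relation.ReflTransGen.refl
    by_cases hl : y + ρ.1 ≤ τ.1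
    · exact ⟨0, 1, x, y, .inl ⟨by omega, by omega, h1, by omega, pos_zero_one _, pos_zero_one _⟩⟩
    by_cases hx : x = 0
    · by_cases hy : y = 1
      · subst hx hy
        refine ⟨0, 0, 0, 0, .inr ?_⟩
        refine ext_of_order (by omega) fun i hi j hj => ?_
        simpa only [pos_zero_one] using h.2.2 i hi j hj
      · refine ⟨0, 2, 0, y - 1, .inl ⟨by omega, by omega, by omega, by omega, ?_, ?_⟩⟩ <;>
          (unfold pos; split_ifs <;> omega)
    · refine ⟨1, 2, x - 1, y - 1, .inl ⟨by omega, by omega, by omega, by omega, ?_, ?_⟩⟩ <;>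
          (unfold pos; split_ifs <;> omega)

lemma QLe.length_le {ρ τ : QPerm} (h : QLe ρ τ) : ρ.1 ≤ τ.1 := by
  induction h with
  | refl => exact le_rfl
  | tail _ hc ih => exact ih.trans (by have := hc.1; omega)

lemma QLe.eq_of_length_le {ρ τ : QPerm} (h : QLe ρ τ) (hl : τ.1 ≤ ρ.1) : ρ = τ := by
  rcases Relation.ReflTransGen.cases_tail h with h | ⟨ζ, h, hc⟩
  · exact h.symm
  · have h1 : ρ.1 ≤ ζ.1 := QLe.length_le h
    have := hc.1
    omega

/-- The interval `[σ, τ]` as a finset. -/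
noncomputable def interval (σ τ : QPerm) : Finset QPerm :=
  (permsUpTo τ.1).filter fun z => QLe σ z ∧ QLe z τ

lemma mem_permsUpTo {n : ℕ} {z : QPerm} : z ∈ permsUpTo n ↔ z.1 ≤ n := by
  simp [permsUpTo]

lemma mem_interval {σ τ z : QPerm} : z ∈ interval σ τ ↔ QLe σ z ∧ QLe z τ := by
  rw [interval, Finset.mem_filter, mem_permsUpTo, and_iff_right_iff_imp]
  exact fun h => QLe.length_le h.2

/-- A function whose sums over nontrivial intervals `[σ, τ]` vanish is the Möbius function. -/
lemma qMu_eq_of_sum_eq_zero {σ : QPerm} (w : QPerm → ℤ) (P : QPerm → Prop)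
    (hP : ∀ ρ τ, QLe σ ρ → QLe ρ τ → P τ → P ρ) (hσ : w σ = 1)
    (hw : ∀ τ, P τ → QLe σ τ → σ ≠ τ → ∑ z ∈ interval σ τ, w z = 0)
    {τ : QPerm} (hτ : P τ) (hle : QLe σ τ) : qMu σ τ = w τ := by
  suffices H : ∀ m τ, τ.1 ≤ m → P τ → QLe σ τ → qMuAux m σ τ = w τ from H _ τ le_rfl hτ hle
  intro m
  induction m with
  | zero =>
    intro τ hm _ hle
    obtain rfl := QLe.eq_of_length_le hle (by omega)
    simp [qMuAux, hσ]
  | succ m ih =>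
    intro τ hm hτ hle
    rw [qMuAux]
    split_ifs with h
    · rw [← h, hσ]
    · have hs : (permsUpTo τ.1).filter (fun z => QLe σ z ∧ QLe z τ ∧ z ≠ τ) =
          (interval σ τ).erase τ := by
        ext z
        simp only [Finset.mem_filter, Finset.mem_erase, interval]
        tauto
      have hmem : τ ∈ interval σ τ := mem_interval.2 ⟨hle, Relation.ReflTransGen.refl⟩
      have hsum : ∑ z ∈ (interval σ τ).erase τ, qMuAux m σ z = ∑ z ∈ (interval σ τ).erase τ, w z := by
        refine Finset.sum_congr rfl fun z hz => ?_
        obtain ⟨hne, hz⟩ := Finset.mem_erase.1 hz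
        obtain ⟨h1, h2⟩ := mem_interval.1 hz
        have hlt : z.1 < τ.1 := by
          by_contra hcon
          exact hne (QLe.eq_of_length_le h2 (by omega))
        exact ih z (by omega) (hP z τ h1 h2 hτ) h1
      rw [hs, hsum]
      have := hw τ hτ hle h
      rw [← Finset.add_sum_erase _ _ hmem] at this
      omega

/-- `σ` occurs in `τ` at the positions `p, q, q + 1, …` and nowhere else. -/
def UniqueAt (σ τ : QPerm) (p q : ℕ) : Prop :=
  Occ σ τ p q ∧ ∀ x y, Occ σ τ x y → x = p ∧ y = q

lemma exists_uniqueAt_of_le {σ ρ τ : QPerm} (hσ : 2 ≤ σ.1) (h1 : QLe σ ρ) (h2 : QLe ρ τ)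
    (h : ∃ p q, UniqueAt σ τ p q) : ∃ p q, UniqueAt σ ρ p q := by
  obtain ⟨p, q, _, hu⟩ := h
  obtain ⟨a, b, hab⟩ := QLe.exists_occ hσ h1
  obtain ⟨x, y, hxy⟩ := QLe.exists_occ (hσ.trans hab.length_le) h2
  refine ⟨a, b, hab, fun a' b' hab' => ?_⟩
  have e := hu _ _ (hab.trans hxy)
  have e' := hu _ _ (hab'.trans hxy)
  exact ⟨pos_injective hxy.1 (e'.1.trans e.1.symm), pos_injective hxy.1 (e'.2.trans e.2.symm)⟩

/-- The first two entries of `τ` are separated by the value of a later entry. -/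
def Sep (τ : QPerm) : Prop :=
  ∃ i, i + 2 < τ.1 ∧ ¬(ev τ 0 < ev τ (i + 2) ↔ ev τ 1 < ev τ (i + 2))

lemma pat_eq_pat_left_iff {τ : QPerm} {m x x' y : ℕ} (h : x < y) (h' : x' < y) :
    pat τ m x y = pat τ m x' y ↔
      ∀ j, j + 1 < m → (ev τ x < ev τ (y + j) ↔ ev τ x' < ev τ (y + j)) := by
  rw [pat_eq_pat_iff h h']
  constructor
  · intro e j hj
    simpa only [pos_succ, pos_zero] using e 0 (by omega) (j + 1) hj
  · intro e i hi j hj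
    rcases i with _ | i <;> rcases j with _ | j
    · simp
    · simpa only [pos_succ, pos_zero] using e j hj
    · have h1 := e i hi
      have h2 : ev τ x ≠ ev τ (y + i) := fun h => by
        have := ev_injective τ h
        omega
      have h3 : ev τ x' ≠ ev τ (y + i) := fun h => by
        have := ev_injective τ h
        omega
      simp only [pos_succ, pos_zero]
      omega
    · simp only [pos_succ]

lemma sep_iff_pat_ne {τ : QPerm} : Sep τ ↔ pat τ (τ.1 - 1) 1 2 ≠ pat τ (τ.1 - 1) 0 2 := by
  rw [ne_eq, pat_eq_pat_left_iff (by omega) (by omega)]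
  simp only [not_forall, exists_prop]
  refine exists_congr fun i => ?_
  rw [add_comm 2 i, show i + 1 < τ.1 - 1 ↔ i + 2 < τ.1 by omega]
  tauto

lemma sep_pat_iff {τ : QPerm} {m x y : ℕ} (h : x < y) :
    Sep (pat τ (m + 1) x y) ↔ pat τ m x (y + 1) ≠ pat τ m y (y + 1) := by
  rcases m with _ | m
  · have : pat τ 0 x (y + 1) = pat τ 0 y (y + 1) :=
      ext_of_order rfl fun i (hi : i < 0) => by omega
    simp only [this, ne_eq, not_true_eq_false, iff_false]
    rintro ⟨i, hi, _⟩
    change i + 2 < 0 + 1 at hi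
    omega
  · rw [sep_iff_pat_ne]
    change pat _ (m + 1) 1 2 ≠ pat _ (m + 1) 0 2 ↔ _
    rw [pat_pat h (by omega) (by omega), pat_pat h (by omega) (by omega), ne_comm]
    rfl

lemma pat_injOn_of_sep {τ : QPerm} {m x x' y : ℕ} (h : x < y) (h' : x' < y)
    (hs : Sep (pat τ (m + 1) x y)) (e : pat τ m x (y + 1) = pat τ m x' (y + 1)) :
    pat τ (m + 1) x y = pat τ (m + 1) x' y := by
  rw [sep_pat_iff h, ne_eq, pat_eq_pat_left_iff (by omega) (by omega)] at hs
  push Not at hs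
  rw [pat_eq_pat_left_iff (by omega) (by omega)] at e
  rw [pat_eq_pat_left_iff h h']
  intro j hj
  rcases j with _ | j
  · obtain ⟨i, hi, hs⟩ := hs
    have := e i hi
    have h2 : ev τ x' ≠ ev τ (y + 1 + i) := fun h => by
      have := ev_injective τ h
      omega
    have h3 : ev τ x ≠ ev τ (y + 1 + i) := fun h => by
      have := ev_injective τ h
      omega
    rw [add_zero]
    omega
  · have := e j (by omega)
    rwa [add_assoc, add_comm 1 j] at this

lemma notConsecFirstTwo_iff_sep {τ : QPerm} (hτ : 2 ≤ τ.1) : NotConsecFirstTwo τ ↔ Sep τ := by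
  have h01 : NotConsecFirstTwo τ ↔ ev τ 0 + 1 ≠ ev τ 1 ∧ ev τ 1 + 1 ≠ ev τ 0 := by
    rw [ev_of_lt (show 0 < τ.1 by omega), ev_of_lt (show 1 < τ.1 by omega)]
    refine ⟨fun h => h _ _ rfl rfl, ?_⟩
    rintro h ⟨i, hi⟩ ⟨j, hj⟩ (rfl : i = 0) (rfl : j = 1)
    exact h
  have hb : ∀ i < τ.1, ev τ i < τ.1 := fun i hi => by
    rw [ev_of_lt hi]
    exact Fin.isLt _
  have hsurj : ∀ v < τ.1, ∃ i < τ.1, ev τ i = v := fun v hv =>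
    ⟨τ.2.symm ⟨v, hv⟩, Fin.isLt _, by rw [ev_of_lt (Fin.isLt _)]; simp⟩
  have h0 := hb 0 (by omega)
  have h1 := hb 1 (by omega)
  have hne : ev τ 0 ≠ ev τ 1 := fun h => by
    have := ev_injective τ h
    omega
  rw [h01]
  constructor
  · intro h
    obtain ⟨i, hi, hv⟩ := hsurj (min (ev τ 0) (ev τ 1) + 1) (by omega)
    have hi0 : i ≠ 0 := by
      rintro rfl
      omega
    have hi1 : i ≠ 1 := by
      rintro rfl
      omega
    obtain ⟨j, rfl⟩ : ∃ j, i = j + 2 := ⟨i - 2, by omega⟩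
    exact ⟨j, hi, by omega⟩
  · rintro ⟨i, hi, hs⟩
    have h2 : ev τ 0 ≠ ev τ (i + 2) := fun h => by
      have := ev_injective τ h
      omega
    have h3 : ev τ 1 ≠ ev τ (i + 2) := fun h => by
      have := ev_injective τ h
      omega
    omega

lemma ncard_coatoms_eq_three_iff {σ τ : QPerm} (hσ : 2 ≤ σ.1) (hl : τ.1 = σ.1 + 3)
    (hu : UniqueAt σ τ 2 3) : {ρ : QPerm | QLe σ ρ ∧ QCov ρ τ}.ncard = 3 ↔ Sep τ := by
  set A := pat τ (τ.1 - 1) 1 2 with hA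
  set B := pat τ (τ.1 - 1) 0 2 with hB
  set C := pat τ (τ.1 - 1) 0 1 with hC
  have oA : Occ A τ 1 2 := occ_pat (by omega) (by omega)
  have oB : Occ B τ 0 2 := occ_pat (by omega) (by omega)
  have oC : Occ C τ 0 1 := occ_pat (by omega) (by omega)
  have lA : A.1 = τ.1 - 1 := rfl
  have lB : B.1 = τ.1 - 1 := rfl
  have lC : C.1 = τ.1 - 1 := rfl
  have sA : Occ σ A 1 2 := Occ.factor oA (by omega) (by omega) hu.1
  have sB : Occ σ B 1 2 := Occ.factor oB (by omega) (by omega) hu.1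
  have sC : Occ σ C 2 3 := Occ.factor oC (by omega) (by omega) hu.1
  have nC : ¬ Occ σ C 1 2 := fun h => by
    have : pos 0 1 1 = 2 := (hu.2 _ _ (h.trans oC)).1
    simp [pos] at this
  have hAC : A ≠ C := fun h => nC (h ▸ sA)
  have hBC : B ≠ C := fun h => nC (h ▸ sB)
  have hset : {ρ : QPerm | QLe σ ρ ∧ QCov ρ τ} = (({A, B, C} : Finset QPerm) : Set QPerm) := by
    ext ρ
    simp only [Set.mem_ofPred_eq, Finset.coe_insert, Finset.coe_singleton, Set.mem_insert_iff,
      Set.mem_singleton_iff]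
    constructor
    · rintro ⟨h1, h2, f, hf⟩
      obtain ⟨x, y, hxy, _⟩ := occ_of_isOcc (hσ.trans (QLe.length_le h1)) hf
      have e := hxy.eq_pat
      obtain ⟨h3, h4, _⟩ := hxy
      rw [show ρ.1 = τ.1 - 1 by omega] at e
      obtain ⟨rfl, rfl⟩ | ⟨rfl, rfl⟩ | ⟨rfl, rfl⟩ :
          x = 1 ∧ y = 2 ∨ x = 0 ∧ y = 2 ∨ x = 0 ∧ y = 1 := by omega
      · exact .inl e
      · exact .inr (.inl e)
      · exact .inr (.inr e)
    · rintro (rfl | rfl | rfl)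
      · exact ⟨sA.qLe, qCov_pat (by omega) (by omega) (by omega)⟩
      · exact ⟨sB.qLe, qCov_pat (by omega) (by omega) (by omega)⟩
      · exact ⟨sC.qLe, qCov_pat (by omega) (by omega) (by omega)⟩
  rw [hset, Set.ncard_coe_finset, sep_iff_pat_ne]
  by_cases hAB : A = B
  · have : ({A, B, C} : Finset QPerm).card ≤ 2 := by
      rw [hAB, Finset.insert_eq_of_mem (Finset.mem_insert_self _ _)]
      exact Finset.card_le_two
    exact ⟨fun h => by omega, fun h => absurd hAB h⟩
  · exact ⟨fun _ => hAB, fun _ => Finset.card_eq_three.2 ⟨A, B, C, hAB, hAC, hBC, rfl⟩⟩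

lemma mem_interval_and_occ_iff {σ τ ρ : QPerm} {p q m a b : ℕ} (hσ : 2 ≤ σ.1)
    (hu : UniqueAt σ τ p q) :
    (ρ ∈ interval σ τ ∧ ρ.1 = m ∧ Occ σ ρ a b) ↔ ∃ x y, x < y ∧ y + m ≤ τ.1 + 1 ∧ a < b ∧
      b + σ.1 ≤ m + 1 ∧ pos x y a = p ∧ pos x y b = q ∧ ρ = pat τ m x y := by
  constructor
  · rintro ⟨h, rfl, hab⟩
    obtain ⟨h1, h2⟩ := mem_interval.1 h
    obtain ⟨x, y, hxy⟩ := QLe.exists_occ (hσ.trans hab.length_le) h2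
    obtain ⟨e1, e2⟩ := hu.2 _ _ (hab.trans hxy)
    exact ⟨x, y, hxy.1, hxy.2.1, hab.1, hab.2.1, e1, e2, hxy.eq_pat⟩
  · rintro ⟨x, y, hxy, hm, hab, hb, rfl, rfl, rfl⟩
    have o := occ_pat hxy hm
    have o' : Occ σ (pat τ m x y) a b := Occ.factor o hab hb hu.1
    exact ⟨mem_interval.2 ⟨o'.qLe, o.qLe⟩, rfl, o'⟩

lemma card_occ_zero {σ τ : QPerm} {p q m b : ℕ} (hσ : 2 ≤ σ.1) (hu : UniqueAt σ τ p q)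
    (hb : 1 ≤ b) :
    ((interval σ τ).filter fun ρ => ρ.1 = m ∧ Occ σ ρ 0 b).card =
      if b + σ.1 ≤ m + 1 ∧ p + b < q + 1 ∧ q + m ≤ τ.1 + b then 1 else 0 := by
  have key : ∀ ρ, ρ ∈ (interval σ τ).filter (fun ρ => ρ.1 = m ∧ Occ σ ρ 0 b) ↔
      (b + σ.1 ≤ m + 1 ∧ p + b < q + 1 ∧ q + m ≤ τ.1 + b) ∧ ρ = pat τ m p (q + 1 - b) := by
    intro ρ
    rw [Finset.mem_filter, mem_interval_and_occ_iff hσ hu]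
    constructor
    · rintro ⟨x, y, h1, h2, h3, h4, h5, h6, rfl⟩
      have h5 : x = p := h5
      have hy : y = q + 1 - b := by
        unfold pos at h6
        split_ifs at h6 <;> omega
      subst h5 hy
      exact ⟨by omega, rfl⟩
    · rintro ⟨h, rfl⟩
      refine ⟨p, q + 1 - b, by omega, by omega, by omega, by omega, rfl, ?_, rfl⟩
      unfold pos
      split_ifs <;> omega
  split_ifs with h
  · refine Finset.card_eq_one.2 ⟨pat τ m p (q + 1 - b), Finset.ext fun ρ => ?_⟩
    rw [key, Finset.mem_singleton, and_iff_right h]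
  · refine Finset.card_eq_zero.2 (Finset.eq_empty_of_forall_notMem fun ρ hρ => ?_)
    exact h ((key ρ).1 hρ).1

lemma card_occ_one_two {σ τ : QPerm} {p q m : ℕ} (hσ : 2 ≤ σ.1) (hu : UniqueAt σ τ p q)
    (hm : σ.1 + 1 ≤ m) :
    ((interval σ τ).filter fun ρ => ρ.1 = m ∧ Occ σ ρ 1 2).card =
      ((interval σ τ).filter fun ρ => ρ.1 = m + 1 ∧ Occ σ ρ 2 3 ∧ Sep ρ).card +
        if 1 ≤ p ∧ q = p + 1 ∧ p + m ≤ τ.1 + 1 then 1 else 0 := by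
  have keyG : ∀ ρ, ρ ∈ (interval σ τ).filter (fun ρ => ρ.1 = m ∧ Occ σ ρ 1 2) ↔
      (q = p + 1 ∧ p + m ≤ τ.1 + 1) ∧ ∃ x < p, ρ = pat τ m x p := by
    intro ρ
    rw [Finset.mem_filter, mem_interval_and_occ_iff hσ hu]
    constructor
    · rintro ⟨x, y, h1, h2, h3, h4, h5, h6, rfl⟩
      rw [pos_succ] at h5 h6
      obtain rfl : y = p := by omega
      exact ⟨by omega, x, h1, rfl⟩
    · rintro ⟨h, x, hx, rfl⟩
      exact ⟨x, p, hx, by omega, by omega, by omega, by rw [pos_succ]; omega,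
        by rw [pos_succ]; omega, rfl⟩
  have keyH : ∀ ρ, ρ ∈ (interval σ τ).filter (fun ρ => ρ.1 = m + 1 ∧ Occ σ ρ 2 3 ∧ Sep ρ) ↔
      (q = p + 1 ∧ p + m ≤ τ.1 + 1) ∧ ∃ x y, x < y ∧ p = y + 1 ∧ ρ = pat τ (m + 1) x y ∧ Sep ρ := by
    intro ρ
    rw [Finset.mem_filter]
    have := mem_interval_and_occ_iff (ρ := ρ) (m := m + 1) (a := 2) (b := 3) hσ hu
    rw [show ∀ P Q R S : Prop, (P ∧ Q ∧ R ∧ S) ↔ (P ∧ Q ∧ R) ∧ S by tauto, this]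
    constructor
    · rintro ⟨⟨x, y, h1, h2, h3, h4, h5, h6, e⟩, hs⟩
      rw [pos_succ] at h5 h6
      exact ⟨by omega, x, y, h1, by omega, e, hs⟩
    · rintro ⟨h, x, y, hx, hy, e, hs⟩
      exact ⟨⟨x, y, hx, by omega, by omega, by omega, by rw [pos_succ]; omega,
        by rw [pos_succ]; omega, e⟩, hs⟩
  split_ifs with h
  · obtain ⟨y, rfl⟩ : ∃ y, p = y + 1 := ⟨p - 1, by omega⟩
    set H := (interval σ τ).filter (fun ρ => ρ.1 = m + 1 ∧ Occ σ ρ 2 3 ∧ Sep ρ)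
    have hd : ∀ x < y, pat (pat τ (m + 1) x y) m 0 2 = pat τ m x (y + 1) := fun x hx => by
      rw [pat_pat hx (by omega) (by omega)]
      rfl
    have hinj : Set.InjOn (fun ρ => pat ρ m 0 2) (H : Set QPerm) := by
      intro ρ hρ ρ' hρ' e
      obtain ⟨_, x, y', hx, hy, rfl, hs⟩ := (keyH ρ).1 hρ
      obtain rfl : y = y' := by omega
      obtain ⟨_, x', y', hx', hy, rfl, hs'⟩ := (keyH ρ').1 hρ'
      obtain rfl : y = y' := by omega
      simp only [hd x hx, hd x' hx'] at e
      exact pat_injOn_of_sep hx hx' hs e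
    have hnot : pat τ m y (y + 1) ∉ H.image fun ρ => pat ρ m 0 2 := by
      intro hmem
      obtain ⟨ρ, hρ, e⟩ := Finset.mem_image.1 hmem
      obtain ⟨_, x, y', hx, hy, rfl, hs⟩ := (keyH ρ).1 hρ
      obtain rfl : y = y' := by omega
      rw [hd x hx] at e
      exact (sep_pat_iff hx).1 hs e
    rw [← Finset.card_image_of_injOn hinj, ← Finset.card_insert_of_notMem hnot]
    congr 1
    ext ρ
    rw [keyG, Finset.mem_insert, Finset.mem_image]
    constructor
    · rintro ⟨h', x, hx, rfl⟩
      by_cases e : pat τ m x (y + 1) = pat τ m y (y + 1)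
      · exact .inl e
      · have hxy : x < y := by
          by_contra hcon
          obtain rfl : x = y := by omega
          exact e rfl
        exact .inr ⟨pat τ (m + 1) x y,
          (keyH _).2 ⟨h', x, y, hxy, rfl, rfl, (sep_pat_iff hxy).2 e⟩, hd x hxy⟩
    · rintro (rfl | ⟨ρ', hρ', rfl⟩)
      · exact ⟨h.2, y, by omega, rfl⟩
      · obtain ⟨_, x, y', hx, hy, rfl, hs⟩ := (keyH ρ').1 hρ'
        obtain rfl : y = y' := by omega
        exact ⟨h.2, x, by omega, hd x hx⟩
  · have hG : (interval σ τ).filter (fun ρ => ρ.1 = m ∧ Occ σ ρ 1 2) = ∅ := by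
      refine Finset.eq_empty_of_forall_notMem fun ρ hρ => ?_
      obtain ⟨h1, x, hx, _⟩ := (keyG ρ).1 hρ
      omega
    have hH : (interval σ τ).filter (fun ρ => ρ.1 = m + 1 ∧ Occ σ ρ 2 3 ∧ Sep ρ) = ∅ := by
      refine Finset.eq_empty_of_forall_notMem fun ρ hρ => ?_
      obtain ⟨h1, x, y, hx, hy, _⟩ := (keyH ρ).1 hρ
      omega
    rw [hG, hH]
    rfl

/-- The values of the Möbius function `μ(σ, ρ)` when `σ` occurs exactly once in `ρ`. -/
noncomputable def weight (σ ρ : QPerm) : ℤ :=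
  (if ρ.1 = σ.1 ∧ Occ σ ρ 0 1 then 1 else 0) - (if ρ.1 = σ.1 + 1 ∧ Occ σ ρ 0 1 then 1 else 0)
    - (if ρ.1 = σ.1 + 1 ∧ Occ σ ρ 0 2 then 1 else 0)
    - (if ρ.1 = σ.1 + 1 ∧ Occ σ ρ 1 2 then 1 else 0)
    + (if ρ.1 = σ.1 + 2 ∧ Occ σ ρ 0 2 then 1 else 0)
    + (if ρ.1 = σ.1 + 2 ∧ Occ σ ρ 1 2 then 1 else 0)
    + (if ρ.1 = σ.1 + 2 ∧ Occ σ ρ 2 3 ∧ Sep ρ then 1 else 0)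
    - (if ρ.1 = σ.1 + 3 ∧ Occ σ ρ 2 3 ∧ Sep ρ then 1 else 0)

lemma sum_weight_eq_zero {σ τ : QPerm} {p q : ℕ} (hσ : 2 ≤ σ.1) (hu : UniqueAt σ τ p q)
    (hle : QLe σ τ) (hne : σ ≠ τ) : ∑ ρ ∈ interval σ τ, weight σ ρ = 0 := by
  have hlt : σ.1 < τ.1 := by
    by_contra hcon
    exact hne (QLe.eq_of_length_le hle (by omega))
  have h1 := hu.1.1
  have h2 := hu.1.2.1
  have e1 := card_occ_one_two (m := σ.1 + 1) hσ hu (by omega)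
  have e2 := card_occ_one_two (m := σ.1 + 2) hσ hu (by omega)
  rw [show σ.1 + 1 + 1 = σ.1 + 2 from rfl] at e1
  rw [show σ.1 + 2 + 1 = σ.1 + 3 from rfl] at e2
  simp only [weight, Finset.sum_add_distrib, Finset.sum_sub_distrib, Finset.sum_boole]
  rw [e1, e2, card_occ_zero hσ hu le_rfl, card_occ_zero hσ hu le_rfl,
    card_occ_zero hσ hu one_le_two, card_occ_zero hσ hu one_le_two]
  push_cast
  split_ifs <;> omega

lemma qMu_eq_weight {σ τ : QPerm} {p q : ℕ} (hσ : 2 ≤ σ.1) (hu : UniqueAt σ τ p q) :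
    qMu σ τ = weight σ τ := by
  refine qMu_eq_of_sum_eq_zero (weight σ) (fun τ => ∃ p q, UniqueAt σ τ p q)
    (fun ρ τ => exists_uniqueAt_of_le hσ) ?_ ?_ ⟨p, q, hu⟩ hu.1.qLe
  · simp [weight, occ_refl]
  · rintro τ ⟨p, q, hu⟩ hle hne
    exact sum_weight_eq_zero hσ hu hle hne

lemma weight_of_uniqueAt {σ τ : QPerm} {p q : ℕ} (hu : UniqueAt σ τ p q) :
    weight σ τ =
      (if τ.1 = σ.1 ∧ p = 0 ∧ q = 1 then 1 else 0)
      - (if τ.1 = σ.1 + 1 ∧ p = 0 ∧ q = 1 then 1 else 0)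
      - (if τ.1 = σ.1 + 1 ∧ p = 0 ∧ q = 2 then 1 else 0)
      - (if τ.1 = σ.1 + 1 ∧ p = 1 ∧ q = 2 then 1 else 0)
      + (if τ.1 = σ.1 + 2 ∧ p = 0 ∧ q = 2 then 1 else 0)
      + (if τ.1 = σ.1 + 2 ∧ p = 1 ∧ q = 2 then 1 else 0)
      + (if τ.1 = σ.1 + 2 ∧ (p = 2 ∧ q = 3) ∧ Sep τ then 1 else 0)
      - (if τ.1 = σ.1 + 3 ∧ (p = 2 ∧ q = 3) ∧ Sep τ then 1 else 0) := by
  have h : ∀ a b, Occ σ τ a b ↔ p = a ∧ q = b := fun a b => by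
    refine ⟨fun h => ?_, ?_⟩
    · have := hu.2 a b h
      omega
    · rintro ⟨rfl, rfl⟩
      exact hu.1
  simp only [weight, h]

/-- The Möbius function from the empty permutation. -/
lemma qMu_of_length_eq_zero {σ τ : QPerm} (hσ : σ.1 = 0) (hle : QLe σ τ) :
    qMu σ τ = (if τ.1 = 0 then 1 else 0) - (if τ.1 = 1 then 1 else 0) := by
  refine qMu_eq_of_sum_eq_zero (fun z => (if z.1 = 0 then (1 : ℤ) else 0) - (if z.1 = 1 then 1 else 0))
    (fun _ => True) (fun _ _ _ _ _ => trivial) (by simp [hσ]) ?_ trivial hle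
  intro τ _ hle hne
  have hlt : σ.1 < τ.1 := by
    by_contra hcon
    exact hne (QLe.eq_of_length_le hle (by omega))
  have huniq : ∀ z z' : QPerm, z.1 = z'.1 → z.1 ≤ 1 → z = z' := fun z z' h h1 =>
    ext_of_order h fun i hi j hj => by
      obtain rfl : i = j := by omega
      simp
  set u := pat τ 1 0 1
  have ou : Occ u τ 0 1 := occ_pat (by omega) (by omega)
  have hsu : QLe σ u := Occ.qLe (x := 0) (y := 1)
    ⟨by omega, by rw [hσ]; omega, fun i hi => by omega⟩
  have h0 : (interval σ τ).filter (fun z => z.1 = 0) = {σ} := by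
    ext z
    rw [Finset.mem_filter, Finset.mem_singleton, mem_interval]
    constructor
    · rintro ⟨_, h⟩
      exact huniq _ _ (by omega) (by omega)
    · rintro rfl
      exact ⟨⟨Relation.ReflTransGen.refl, hle⟩, hσ⟩
  have h1 : (interval σ τ).filter (fun z => z.1 = 1) = {u} := by
    ext z
    rw [Finset.mem_filter, Finset.mem_singleton, mem_interval]
    constructor
    · rintro ⟨_, h⟩
      exact huniq _ _ h (by omega)
    · rintro rfl
      exact ⟨⟨hsu, ou.qLe⟩, rfl⟩
  rw [Finset.sum_sub_distrib, Finset.sum_boole, Finset.sum_boole, h0, h1]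
  simp

lemma qMu_self (σ : QPerm) : qMu σ σ = 1 := by
  rw [qMu]
  cases σ.1 <;> simp [qMuAux]

lemma exists_uniqueAt_of_isOcc {σ τ : QPerm} (hσ : 2 ≤ σ.1) {f : Fin σ.1 → Fin τ.1}
    (hf : IsOcc qa σ.2 τ.2 f) (huniq : ∀ g : Fin σ.1 → Fin τ.1, IsOcc qa σ.2 τ.2 g → g = f) :
    ∃ p q, UniqueAt σ τ p q ∧ ∀ i, (f i : ℕ) = pos p q i := by
  obtain ⟨p, q, hpq, hfpos⟩ := occ_of_isOcc hσ hf
  refine ⟨p, q, ⟨hpq, fun x y hxy => ?_⟩, hfpos⟩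
  obtain ⟨g, hg, hgpos⟩ := hxy.exists_isOcc
  obtain rfl := huniq g hg
  have h0 := (hgpos ⟨0, by omega⟩).symm.trans (hfpos ⟨0, by omega⟩)
  have h1 := (hgpos ⟨1, by omega⟩).symm.trans (hfpos ⟨1, by omega⟩)
  simpa [pos] using And.intro h0 h1

lemma involves_iff {k n p q : ℕ} (hk : 2 ≤ k) {f : Fin k → Fin n}
    (hf : ∀ i, (f i : ℕ) = pos p q i) (i : ℕ) :
    Involves f i ↔ i = p ∨ q ≤ i ∧ i + 1 < q + k := by
  constructor
  · rintro ⟨⟨j, hj⟩, rfl⟩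
    rw [hf]
    rcases j with _ | j
    · exact .inl rfl
    · simp only [pos_succ]
      omega
  · rintro (rfl | h)
    · exact ⟨⟨0, by omega⟩, hf _⟩
    · refine ⟨⟨i - q + 1, by omega⟩, ?_⟩
      rw [hf, pos_succ]
      omega

lemma consecOcc_iff {k n p q : ℕ} (hk : 2 ≤ k) {f : Fin k → Fin n}
    (hf : ∀ i, (f i : ℕ) = pos p q i) : ConsecOcc f ↔ q = p + 1 := by
  constructor
  · intro h
    have := h 0 (by omega)
    simpa [hf, pos] using this
  · rintro rfl i hi
    rw [hf, hf]
    rcases i with _ | i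
    · rfl
    · simp only [pos_succ]
      omega

end QPattern

/-- Complete determination of the Möbius function of the quasi-consecutive
pattern poset in the case of a single occurrence of `σ` in `τ`. -/
theorem mobius_single_occurrence (hle : QLe σ τ)
    (hf : IsOcc qa σ.2 τ.2 f)
    (huniq : ∀ g : Fin σ.1 → Fin τ.1, IsOcc qa σ.2 τ.2 g → g = f) :
    (σ = τ → qMu σ τ = 1) ∧
    (QCov σ τ → qMu σ τ = -1) ∧
    (CaseThree σ τ f → qMu σ τ = 1) ∧
    (CaseFour σ τ f → qMu σ τ = 1) ∧
    (CaseFive σ τ f → qMu σ τ = -1) ∧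
    (σ ≠ τ → ¬ QCov σ τ → ¬ CaseThree σ τ f → ¬ CaseFour σ τ f →
      ¬ CaseFive σ τ f → qMu σ τ = 0) := by
  have hcov : QCov σ τ ↔ τ.1 = σ.1 + 1 := ⟨fun h => h.1.symm, fun h => ⟨h.symm, f, hf⟩⟩
  have heq : σ = τ ↔ τ.1 = σ.1 :=
    ⟨fun h => by rw [h], fun h => QPattern.QLe.eq_of_length_le hle h.le⟩
  obtain hσ | hσ | hσ : σ.1 = 0 ∨ σ.1 = 1 ∨ 2 ≤ σ.1 := by omega
  · have hinv : ∀ i, ¬ Involves f i := by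
      rintro i ⟨j, _⟩
      exact absurd j.2 (by omega)
    simp only [QPattern.qMu_of_length_eq_zero hσ hle, hcov, heq, CaseThree, CaseFour, CaseFive,
      hinv, hσ, false_and, and_false, or_false, false_implies, true_and, ne_eq, not_false_eq_true,
      true_implies]
    refine ⟨?_, ?_, ?_⟩ <;> intros <;> split_ifs <;> omega
  · have hτ : τ.1 = 1 := by
      have hocc : ∀ j : Fin τ.1, IsOcc qa σ.2 τ.2 fun _ => j := fun j => by
        have : Subsingleton (Fin σ.1) := by
          rw [hσ]
          infer_instance
        refine ⟨Subsingleton.strictMono _, fun i i' => ?_, fun i h => by omega⟩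
        rw [Subsingleton.elim i i']
        simp
      by_contra hτ
      have := QPattern.QLe.length_le hle
      have h01 := congrFun ((huniq _ (hocc ⟨0, by omega⟩)).trans
        (huniq _ (hocc ⟨1, by omega⟩)).symm) ⟨0, by omega⟩
      simp at h01
    obtain rfl := heq.2 (by omega)
    simp [QPattern.qMu_self, hcov, CaseThree, CaseFour, CaseFive]
  · obtain ⟨p, q, hu, hpos⟩ := QPattern.exists_uniqueAt_of_isOcc hσ hf huniq
    have h1 := hu.1.1
    have h2 := hu.1.2.1
    have h3 : CaseThree σ τ f ↔ τ.1 = σ.1 + 2 ∧ (p = 0 ∨ p = 1) ∧ q = 2 := by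
      simp only [CaseThree, QPattern.involves_iff hσ hpos]
      omega
    have h4 : CaseFour σ τ f ↔ τ.1 = σ.1 + 2 ∧ (p = 2 ∧ q = 3) ∧ QPattern.Sep τ := by
      simp only [CaseFour, QPattern.involves_iff hσ hpos,
        QPattern.notConsecFirstTwo_iff_sep (hσ.trans (QPattern.QLe.length_le hle))]
      by_cases hs : QPattern.Sep τ <;> simp only [hs, and_true, and_false]
      omega
    have h5 : CaseFive σ τ f ↔ τ.1 = σ.1 + 3 ∧ (p = 2 ∧ q = 3) ∧ QPattern.Sep τ := by
      have harith : τ.1 - σ.1 = 3 ∧ ConsecOcc f ∧ Involves f (τ.1 - 2) ∧ ¬ Involves f 0 ∧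
          ¬ Involves f 1 ∧ ¬ Involves f (τ.1 - 1) ↔ τ.1 = σ.1 + 3 ∧ p = 2 ∧ q = 3 := by
        simp only [QPattern.involves_iff hσ hpos, QPattern.consecOcc_iff hσ hpos]
        omega
      constructor
      · rintro ⟨a1, a2, a3, a4, a5, a6, hn⟩
        obtain ⟨hl, rfl, rfl⟩ := harith.1 ⟨a1, a2, a3, a4, a5, a6⟩
        exact ⟨hl, ⟨rfl, rfl⟩, (QPattern.ncard_coatoms_eq_three_iff hσ hl hu).1 hn⟩
      · rintro ⟨hl, ⟨rfl, rfl⟩, hs⟩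
        obtain ⟨a1, a2, a3, a4, a5, a6⟩ := harith.2 ⟨hl, rfl, rfl⟩
        exact ⟨a1, a2, a3, a4, a5, a6, (QPattern.ncard_coatoms_eq_three_iff hσ hl hu).2 hs⟩
    rw [QPattern.qMu_eq_weight hσ hu, QPattern.weight_of_uniqueAt hu, hcov, ne_eq, heq, h3, h4, h5]
    refine ⟨fun h => ?_, fun h => ?_, ?_, ?_, ?_, fun a1 a2 a3 a4 a5 => ?_⟩
    · obtain ⟨rfl, rfl⟩ : p = 0 ∧ q = 1 := by omega
      simp [h]
    · obtain ⟨rfl, rfl⟩ | ⟨rfl, rfl⟩ | ⟨rfl, rfl⟩ :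
          p = 0 ∧ q = 1 ∨ p = 0 ∧ q = 2 ∨ p = 1 ∧ q = 2 := by omega
      all_goals simp [h]
    · rintro ⟨h, rfl | rfl, rfl⟩ <;> simp [h]
    · rintro ⟨h, ⟨rfl, rfl⟩, hs⟩
      simp [h, hs]
    · rintro ⟨h, ⟨rfl, rfl⟩, hs⟩
      simp [h, hs]
    · rw [if_neg (by omega), if_neg (by omega), if_neg (by omega), if_neg (by omega),
        if_neg (by omega), if_neg (by omega), if_neg a4, if_neg a5]
      rfl

end MainTheorem
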